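/- Let a₊, a₋ ∈ (0,2)\{1}, let C₊, C₋, λ₊, λ₋, μ₊, μ₋ > 0, T > 0 and α ∈ (−1,1), and set p = (1−α)/2, q = (1+α)/2. Define r : ℝ → ℝ by r(x) = exp(−(λ₊−μ₊)x) for x > 0 and r(x) = exp(−(λ₋−μ₋)|x|) for x < 0, and let ℓ̃ be the GTS Lévy density with parameters (a₊, a₋, C₊, C₋, μ₊, μ₋). Then the function x ↦ (p·r(x) + q − r(x)^p)·ℓ̃(x) is integrable on ℝ and (4T/(1−α²))·∫_ℝ (p·r(x) + q − r(x)^p)·ℓ̃(x) dx = (4T/(1−α²))·[ C₊·Γ(−a₊)·(p·λ₊^{a₊} + q·μ₊^{a₊} − (pλ₊+qμ₊)^{a₊}) + C₋·Γ(−a₋)·(p·λ₋^{a₋} + q·μ₋^{a₋} − (pλ₋+qμ₋)^{a₋}) ]. -/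

import Mathlib

open MeasureTheory Real Set

/-- The GTS (generalized tempered stable) Lévy density with parameters
`(a₊, a₋, C₊, C₋, θ₊, θ₋)`. -/
noncomputable def gtsDensity (ap am Cp Cm tp tm : ℝ) (x : ℝ) : ℝ :=
  if 0 < x then Cp * exp (-(tp * x)) * x ^ (-ap - 1)
  else if x < 0 then Cm * exp (-(tm * |x|)) * |x| ^ (-am - 1)
  else 0

open Filter Topology

/-- The gap between a combination of two decaying exponentials and a third one. -/
noncomputable def expGap (p q l m n x : ℝ) : ℝ :=
  p * exp (-(l * x)) + q * exp (-(m * x)) - exp (-(n * x))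

lemma hasDerivAt_expGap (p q l m n k : ℝ) (x : ℝ) :
    HasDerivAt
      (fun x => p * exp (-(l * x)) + q * exp (-(m * x)) - k * exp (-(n * x)))
      (-(p * l) * exp (-(l * x)) + -(q * m) * exp (-(m * x)) - -(k * n) * exp (-(n * x))) x := by
  have h (θ : ℝ) : HasDerivAt (fun x => exp (-(θ * x))) (exp (-(θ * x)) * -(θ * 1)) x :=
    (((hasDerivAt_id x).const_mul θ).neg).exp
  exact ((((h l).const_mul p).add ((h m).const_mul q)).sub ((h n).const_mul k)).congr_deriv
    (by ring)

lemma integrableOn_rpow_mul_exp_neg_mul_Ioi {s θ : ℝ} (hs : 0 < s) (hθ : 0 < θ) :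
    IntegrableOn (fun x : ℝ => x ^ (s - 1) * exp (-(θ * x))) (Ioi 0) := by
  simpa using integrableOn_rpow_mul_exp_neg_mul_rpow (p := 1) (s := s - 1) (by linarith) one_pos hθ

lemma tendsto_expGap_mul_rpow {l m n : ℝ} (p q k s : ℝ) (hl : 0 < l) (hm : 0 < m) (hn : 0 < n) :
    Tendsto (fun x => (p * exp (-(l * x)) + q * exp (-(m * x)) - k * exp (-(n * x))) * x ^ s)
      atTop (𝓝 0) := by
  have h (θ : ℝ) (hθ : 0 < θ) := tendsto_rpow_mul_exp_neg_mul_atTop_nhds_zero s θ hθ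
  have := (((h l hl).const_mul p).add ((h m hm).const_mul q)).sub ((h n hn).const_mul k)
  simp only [mul_zero, add_zero, sub_zero] at this
  exact this.congr fun x => by simp only [neg_mul]; ring

/-- A function vanishing at `0` whose derivative is bounded by `C` on `[0, x]`. -/
lemma abs_le_mul_of_hasDerivAt {f f' : ℝ → ℝ} {C x : ℝ} (hf : ∀ y, HasDerivAt f (f' y) y)
    (h0 : f 0 = 0) (hx : 0 ≤ x) (hC : ∀ y ∈ Icc 0 x, |f' y| ≤ C) : |f x| ≤ C * x := by
  have := (convex_Icc 0 x).norm_image_sub_le_of_norm_hasDerivWithin_le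
    (fun y _ => (hf y).hasDerivWithinAt) hC (left_mem_Icc.2 hx) (right_mem_Icc.2 hx)
  simpa [h0, abs_of_nonneg hx] using this

/-- The Frullani-type integral behind the divergence of one-sided tempered stable laws: the
second-order cancellation at `0` makes it converge for all `a < 2`. -/
lemma integral_expGap_mul_rpow {a p q l m n : ℝ} (ha : a ∈ Ioo (0 : ℝ) 2) (ha1 : a ≠ 1)
    (hl : 0 < l) (hm : 0 < m) (hn : 0 < n) (hpq : p + q = 1) (hlm : p * l + q * m = n) :
    IntegrableOn (fun x => expGap p q l m n x * x ^ (-a - 1)) (Ioi 0) ∧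
    ∫ x in Ioi 0, expGap p q l m n x * x ^ (-a - 1)
      = Gamma (-a) * (p * l ^ a + q * m ^ a - n ^ a) := by
  obtain ⟨ha0, ha2⟩ := ha
  have h1a : 1 - a ≠ 0 := sub_ne_zero.2 ha1.symm
  set f : ℝ → ℝ := fun x => p * exp (-(l * x)) + q * exp (-(m * x)) - 1 * exp (-(n * x)) with hf
  set f₁ : ℝ → ℝ := fun x => -(p * l) * exp (-(l * x)) + -(q * m) * exp (-(m * x))
    - -(1 * n) * exp (-(n * x)) with hf₁
  set f₂ : ℝ → ℝ := fun x => p * l ^ 2 * exp (-(l * x)) + q * m ^ 2 * exp (-(m * x))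
    - n ^ 2 * exp (-(n * x)) with hf₂
  have hgap : expGap p q l m n = f := by ext x; simp [expGap, hf]
  have hd (x : ℝ) : HasDerivAt f (f₁ x) x := hasDerivAt_expGap p q l m n 1 x
  have hd₁ (x : ℝ) : HasDerivAt f₁ (f₂ x) x :=
    (hasDerivAt_expGap (-(p * l)) (-(q * m)) l m n (-(1 * n)) x).congr_deriv
      (by simp only [hf₂]; ring)
  have hf0 : f 0 = 0 := by simp [hf, hpq]
  have hf₁0 : f₁ 0 = 0 := by simp [hf₁]; linarith
  have hexp {θ x : ℝ} (hθ : 0 < θ) (hx : 0 ≤ x) : exp (-(θ * x)) ≤ 1 :=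
    exp_le_one_iff.2 (by nlinarith)
  have hb (A B D : ℝ) {x : ℝ} (hx : 0 ≤ x) :
      |A * exp (-(l * x)) + B * exp (-(m * x)) - D * exp (-(n * x))| ≤ |A| + |B| + |D| := by
    have key (A θ : ℝ) (hθ : 0 < θ) : |A * exp (-(θ * x))| ≤ |A| := by
      rw [abs_mul, abs_of_pos (exp_pos _)]
      exact mul_le_of_le_one_right (abs_nonneg _) (hexp hθ hx)
    exact (abs_sub _ _).trans (add_le_add ((abs_add_le _ _).trans
      (add_le_add (key A l hl) (key B m hm))) (key D n hn))
  obtain ⟨M, hM⟩ : ∃ M, ∀ x, 0 ≤ x → |f₂ x| ≤ M := ⟨_, fun x hx => hb _ _ _ hx⟩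
  obtain ⟨N, hN⟩ : ∃ N, ∀ x, 0 ≤ x → |f x| ≤ N := ⟨_, fun x hx => hb _ _ _ hx⟩
  have hM0 : 0 ≤ M := (abs_nonneg _).trans (hM 0 le_rfl)
  have hf₁b {x : ℝ} (hx : 0 ≤ x) : |f₁ x| ≤ M * x :=
    abs_le_mul_of_hasDerivAt hd₁ hf₁0 hx fun y hy => hM y hy.1
  have hfb {x : ℝ} (hx : 0 ≤ x) : |f x| ≤ M * x * x :=
    abs_le_mul_of_hasDerivAt hd hf0 hx fun y hy =>
      (hf₁b hy.1).trans (mul_le_mul_of_nonneg_left hy.2 hM0)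
  have hcont : ContinuousOn (fun x => f x * x ^ (-a - 1)) (Ioi 0) := fun x hx =>
    ((hd x).continuousAt.mul (continuousAt_rpow_const x _ (Or.inl (ne_of_gt hx)))).continuousWithinAt
  have hfint : IntegrableOn (fun x => f x * x ^ (-a - 1)) (Ioi 0) := by
    rw [← Ioc_union_Ioi_eq_Ioi zero_le_one]
    refine IntegrableOn.union ?_ ?_
    · have hi : IntegrableOn (fun x : ℝ => M * x ^ (1 - a)) (Ioc 0 1) :=
        ((intervalIntegrable_iff_integrableOn_Ioc_of_le zero_le_one).1
          (intervalIntegral.intervalIntegrable_rpow' (by linarith))).const_mul M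
      refine hi.mono' ((hcont.mono Ioc_subset_Ioi_self).aestronglyMeasurable measurableSet_Ioc) ?_
      refine (ae_restrict_iff' measurableSet_Ioc).2 (.of_forall fun x hx => ?_)
      have hx0 : 0 < x := hx.1
      rw [norm_eq_abs, abs_mul, abs_of_pos (rpow_pos_of_pos hx0 _)]
      refine (mul_le_mul_of_nonneg_right (hfb hx0.le) (rpow_pos_of_pos hx0 _).le).trans_eq ?_
      rw [show 1 - a = 1 + (1 + (-a - 1)) by ring, rpow_add hx0, rpow_add hx0, rpow_one]
      ring
    · have hi : IntegrableOn (fun x : ℝ => N * x ^ (-a - 1)) (Ioi 1) :=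
        (integrableOn_Ioi_rpow_of_lt (by linarith) one_pos).const_mul N
      refine hi.mono' ((hcont.mono (Ioi_subset_Ioi zero_le_one)).aestronglyMeasurable
        measurableSet_Ioi) ?_
      refine (ae_restrict_iff' measurableSet_Ioi).2 (.of_forall fun x hx => ?_)
      have hx0 : 0 < x := one_pos.trans hx
      rw [norm_eq_abs, abs_mul, abs_of_pos (rpow_pos_of_pos hx0 _)]
      exact mul_le_mul_of_nonneg_right (hN x hx0.le) (rpow_pos_of_pos hx0 _).le
  have hI {θ : ℝ} (hθ : 0 < θ) (c : ℝ) : IntegrableOn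
      (fun x : ℝ => c * (x ^ (2 - a - 1) * exp (-(θ * x)))) (Ioi 0) :=
    (integrableOn_rpow_mul_exp_neg_mul_Ioi (by linarith) hθ).const_mul c
  have hsplit : (fun x : ℝ => f₂ x * x ^ (1 - a)) = fun x =>
      p * l ^ 2 * (x ^ (2 - a - 1) * exp (-(l * x)))
      + q * m ^ 2 * (x ^ (2 - a - 1) * exp (-(m * x)))
      - n ^ 2 * (x ^ (2 - a - 1) * exp (-(n * x))) := by
    ext x
    rw [show 2 - a - 1 = 1 - a by ring]
    simp only [hf₂]
    ring
  have hfint₂ : IntegrableOn (fun x => f₂ x * x ^ (1 - a)) (Ioi 0) := by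
    rw [hsplit]
    exact ((hI hl _).add (hI hm _)).sub (hI hn _)
  have hscale {θ : ℝ} (hθ : 0 < θ) : θ ^ 2 * (1 / θ) ^ (2 - a) = θ ^ a := by
    rw [one_div, inv_rpow hθ.le, ← rpow_neg hθ.le, ← rpow_two, ← rpow_add hθ]
    congr 1
    ring
  have hval₂ : ∫ x in Ioi 0, f₂ x * x ^ (1 - a)
      = Gamma (2 - a) * (p * l ^ a + q * m ^ a - n ^ a) := by
    have h2a : 0 < 2 - a := by linarith
    rw [hsplit, integral_sub (by exact (hI hl _).add (hI hm _)) (hI hn _),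
      integral_add (hI hl _) (hI hm _)]
    simp only [integral_const_mul]
    rw [integral_rpow_mul_exp_neg_mul_Ioi h2a hl, integral_rpow_mul_exp_neg_mul_Ioi h2a hm,
      integral_rpow_mul_exp_neg_mul_Ioi h2a hn, ← hscale hl, ← hscale hm, ← hscale hn]
    ring
  have hGamma : Gamma (2 - a) = (1 - a) * (-a * Gamma (-a)) := by
    rw [← Gamma_add_one (neg_ne_zero.2 ha0.ne'), show -a + 1 = 1 - a by ring, ← Gamma_add_one h1a]
    congr 1
    ring
  have hFTC : ∫ x in Ioi 0, (f x * x ^ (-a - 1) + (a * (1 - a))⁻¹ * (f₂ x * x ^ (1 - a))) = 0 := by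
    set G : ℝ → ℝ := fun x => -a⁻¹ * (f x * x ^ (-a)) + (a * (1 - a))⁻¹ * (f₁ x * x ^ (1 - a))
      with hG
    have hG0 : G 0 = 0 := by simp [hG, hf0, hf₁0]
    have hGc : ContinuousWithinAt G (Ici 0) 0 := by
      rw [ContinuousWithinAt, hG0]
      have hlim : Tendsto (fun x : ℝ => (|-a⁻¹| * M + |(a * (1 - a))⁻¹| * M) * x ^ (2 - a))
          (𝓝[Ici 0] 0) (𝓝 0) := by
        have := ((continuousAt_rpow_const 0 (2 - a) (Or.inr (by linarith))).tendsto.const_mul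
          (|-a⁻¹| * M + |(a * (1 - a))⁻¹| * M)).mono_left (nhdsWithin_le_nhds (s := Ici 0))
        rwa [zero_rpow (by linarith), mul_zero] at this
      refine squeeze_zero_norm' ?_ hlim
      filter_upwards [self_mem_nhdsWithin] with x hx
      rcases (show 0 ≤ x from hx).eq_or_lt with rfl | hx0
      · rw [hG0, zero_rpow (by linarith)]; simp
      have e1 : |f x * x ^ (-a)| ≤ M * x ^ (2 - a) := by
        rw [abs_mul, abs_of_pos (rpow_pos_of_pos hx0 _)]
        refine (mul_le_mul_of_nonneg_right (hfb hx0.le) (rpow_pos_of_pos hx0 _).le).trans_eq ?_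
        rw [show 2 - a = 1 + (1 + -a) by ring, rpow_add hx0, rpow_add hx0, rpow_one]
        ring
      have e2 : |f₁ x * x ^ (1 - a)| ≤ M * x ^ (2 - a) := by
        rw [abs_mul, abs_of_pos (rpow_pos_of_pos hx0 _)]
        refine (mul_le_mul_of_nonneg_right (hf₁b hx0.le) (rpow_pos_of_pos hx0 _).le).trans_eq ?_
        rw [show 2 - a = 1 + (1 - a) by ring, rpow_add hx0 1, rpow_one]
        ring
      calc ‖G x‖ ≤ |-a⁻¹| * |f x * x ^ (-a)| + |(a * (1 - a))⁻¹| * |f₁ x * x ^ (1 - a)| := by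
            rw [← abs_mul, ← abs_mul]; exact abs_add_le _ _
        _ ≤ |-a⁻¹| * (M * x ^ (2 - a)) + |(a * (1 - a))⁻¹| * (M * x ^ (2 - a)) := by gcongr
        _ = _ := by ring
    have hGd (x : ℝ) (hx : x ∈ Ioi 0) : HasDerivAt G
        (f x * x ^ (-a - 1) + (a * (1 - a))⁻¹ * (f₂ x * x ^ (1 - a))) x := by
      have hx0 : x ≠ 0 := ne_of_gt hx
      have d1 := ((hd x).mul (hasDerivAt_rpow_const (p := -a) (Or.inl hx0))).const_mul (-a⁻¹)
      have d2 := ((hd₁ x).mul (hasDerivAt_rpow_const (p := 1 - a) (Or.inl hx0))).const_mul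
        (a * (1 - a))⁻¹
      refine (d1.add d2).congr_deriv ?_
      rw [show 1 - a - 1 = -a by ring]
      field_simp
      ring
    have hGt : Tendsto G atTop (𝓝 0) := by
      have := ((tendsto_expGap_mul_rpow p q 1 (-a) hl hm hn).const_mul (-a⁻¹)).add
        ((tendsto_expGap_mul_rpow (-(p * l)) (-(q * m)) (-(1 * n)) (1 - a) hl hm hn).const_mul
          (a * (1 - a))⁻¹)
      simpa only [mul_zero, add_zero] using this
    rw [integral_Ioi_of_hasDerivAt_of_tendsto hGc hGd (hfint.add (hfint₂.const_mul _)) hGt, hG0,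
      sub_zero]
  rw [hgap]
  refine ⟨hfint, ?_⟩
  rw [integral_add hfint (hfint₂.const_mul _), integral_const_mul, hval₂, hGamma] at hFTC
  rw [eq_neg_of_add_eq_zero_left hFTC]
  field_simp

/-- The tilted density ratio against a tempered stable density is a gap of exponentials. -/
lemma tilt_mul_tempered_eq_expGap {p q l m : ℝ} (hpq : p + q = 1) (C a x : ℝ) :
    (p * exp (-((l - m) * x)) + q - exp (-((l - m) * x)) ^ p) * (C * exp (-(m * x)) * x ^ (-a - 1))
      = C * (expGap p q l m (p * l + q * m) x * x ^ (-a - 1)) := by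
  have e1 : exp (-((l - m) * x)) * exp (-(m * x)) = exp (-(l * x)) := by
    rw [← exp_add]; congr 1; ring
  have e2 : exp (-((l - m) * x)) ^ p * exp (-(m * x)) = exp (-((p * l + q * m) * x)) := by
    rw [← exp_mul, ← exp_add]
    congr 1
    linear_combination (m * x) * hpq
  rw [expGap, ← e1, ← e2]
  ring

/-- α-divergence (α ≠ ±1) between two equivalent-martingale GTS processes. -/
theorem gts_alpha_divergence (ap am Cp Cm lp lm mp mm T α p q : ℝ)
    (hap : ap ∈ Ioo (0:ℝ) 2) (hap1 : ap ≠ 1)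
    (ham : am ∈ Ioo (0:ℝ) 2) (ham1 : am ≠ 1)
    (hCp : 0 < Cp) (hCm : 0 < Cm) (hlp : 0 < lp) (hlm : 0 < lm)
    (hmp : 0 < mp) (hmm : 0 < mm) (hT : 0 < T) (hα : α ∈ Ioo (-1:ℝ) 1)
    (hp : p = (1 - α) / 2) (hq : q = (1 + α) / 2)
    (r : ℝ → ℝ)
    (hrp : ∀ x : ℝ, 0 < x → r x = exp (-((lp - mp) * x)))
    (hrm : ∀ x : ℝ, x < 0 → r x = exp (-((lm - mm) * |x|))) :
    Integrable (fun x : ℝ => (p * r x + q - r x ^ p) * gtsDensity ap am Cp Cm mp mm x) ∧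
    (4 * T / (1 - α ^ 2)) *
        ∫ x : ℝ, (p * r x + q - r x ^ p) * gtsDensity ap am Cp Cm mp mm x
      = (4 * T / (1 - α ^ 2)) *
        (Cp * Gamma (-ap) * (p * lp ^ ap + q * mp ^ ap - (p * lp + q * mp) ^ ap)
          + Cm * Gamma (-am) * (p * lm ^ am + q * mm ^ am - (p * lm + q * mm) ^ am)) := by
  have hpq : p + q = 1 := by rw [hp, hq]; ring
  have hp0 : 0 < p := by rw [hp]; linarith [hα.2]
  have hq0 : 0 < q := by rw [hq]; linarith [hα.1]
  obtain ⟨hip, hvp⟩ := integral_expGap_mul_rpow hap hap1 hlp hmp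
    (add_pos (mul_pos hp0 hlp) (mul_pos hq0 hmp)) hpq rfl
  obtain ⟨him, hvm⟩ := integral_expGap_mul_rpow ham ham1 hlm hmm
    (add_pos (mul_pos hp0 hlm) (mul_pos hq0 hmm)) hpq rfl
  set F : ℝ → ℝ := fun x => (p * r x + q - r x ^ p) * gtsDensity ap am Cp Cm mp mm x with hF
  have hpos : EqOn (fun x => Cp * (expGap p q lp mp (p * lp + q * mp) x * x ^ (-ap - 1))) F
      (Ioi 0) := fun x (hx : 0 < x) => by
    simp only [hF, gtsDensity, if_pos hx, hrp x hx, tilt_mul_tempered_eq_expGap hpq]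
  have hneg : EqOn (fun x => Cm * (expGap p q lm mm (p * lm + q * mm) x * x ^ (-am - 1)))
      (fun x => F (-x)) (Ioi 0) := fun x (hx : 0 < x) => by
    have hx' : -x < 0 := neg_lt_zero.2 hx
    simp only [hF, gtsDensity, if_neg hx'.not_gt, if_pos hx', hrm _ hx', abs_neg, abs_of_pos hx,
      tilt_mul_tempered_eq_expGap hpq]
  have hFp : IntegrableOn F (Ioi 0) := IntegrableOn.congr_fun (hip.const_mul Cp) hpos
    measurableSet_Ioi
  have hFm : IntegrableOn F (Iic 0) := by
    have h : IntegrableOn (fun x => F (-x)) (Ioi 0) :=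
      IntegrableOn.congr_fun (him.const_mul Cm) hneg measurableSet_Ioi
    rw [integrableOn_Iic_iff_integrableOn_Iio]
    have := (Measure.measurePreserving_neg (volume : Measure ℝ)).integrableOn_comp_preimage
      (Homeomorph.neg ℝ).measurableEmbedding (f := F) (s := Iio 0)
    rw [← this]
    simpa [Function.comp_def] using h
  refine ⟨?_, ?_⟩
  · rw [← integrableOn_univ, ← Iic_union_Ioi (a := (0 : ℝ))]
    exact hFm.union hFp
  · have hm := integral_comp_neg_Ioi 0 F
    rw [neg_zero] at hm
    rw [← intervalIntegral.integral_Iic_add_Ioi hFm hFp, ← hm,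
      ← setIntegral_congr_fun measurableSet_Ioi hneg,
      ← setIntegral_congr_fun measurableSet_Ioi hpos, integral_const_mul, integral_const_mul,
      hvp, hvm]
    ring
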